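/- Let H be a complex Hilbert space and let A be a densely defined closed linear operator in H with adjoint A*. Let y : [0,∞) → H be strongly continuous. Then the following are equivalent: (i) for every g in the domain of A*, the scalar function t ↦ ⟨y(t), g⟩ is differentiable on [0,∞) with derivative d/dt ⟨y(t), g⟩ = ⟨y(t), A* g⟩ for all t ≥ 0; (ii) for every t ≥ 0, the vector ∫₀ᵗ y(s) ds belongs to the domain of A and y(t) = y(0) + A ∫₀ᵗ y(s) ds. -/

import Mathlib

open scoped InnerProductSpace

/-- A pair annihilated by the graph relation of the adjoint of a densely defined closed operator
lies in the graph of the operator. -/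
theorem mem_graph_of_forall_inner_adjoint_eq
    {H : Type*} [NormedAddCommGroup H] [InnerProductSpace ℂ H] [CompleteSpace H]
    {A : H →ₗ.[ℂ] H} (hdense : Dense (A.domain : Set H)) (hclosed : A.IsClosed) {x z : H}
    (h : ∀ g : A.adjoint.domain, ⟪x, A.adjoint g⟫_ℂ = ⟪z, (g : H)⟫_ℂ) :
    (x, z) ∈ A.graph := by
  let G : Submodule ℂ (WithLp 2 (H × H)) :=
    A.graph.comap (WithLp.linearEquiv 2 ℂ (H × H)).toLinearMap
  have hG : IsClosed (G : Set (WithLp 2 (H × H))) :=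
    hclosed.preimage (WithLp.prod_continuous_ofLp 2 H H)
  have : CompleteSpace G := hG.completeSpace_coe
  suffices hmem : WithLp.toLp 2 (x, z) ∈ G from hmem
  rw [← G.orthogonal_orthogonal, Submodule.mem_orthogonal]
  intro v hv
  rw [Submodule.mem_orthogonal'] at hv
  have hA (u : A.domain) : ⟪-v.fst, (u : H)⟫_ℂ = ⟪v.snd, A u⟫_ℂ := by
    have := hv (WithLp.toLp 2 ((u : H), A u)) (A.mem_graph u)
    rw [WithLp.prod_inner_apply] at this
    rw [inner_neg_left]
    exact neg_eq_of_add_eq_zero_right this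
  have hb := A.mem_adjoint_domain_of_exists v.snd ⟨-v.fst, hA⟩
  have hadj := LinearPMap.adjoint_apply_eq hdense ⟨v.snd, hb⟩ hA
  have hxz := h ⟨v.snd, hb⟩
  rw [hadj, inner_neg_right] at hxz
  rw [← inner_conj_symm, WithLp.prod_inner_apply, map_eq_zero]
  change ⟪x, v.fst⟫_ℂ + ⟪z, v.snd⟫_ℂ = 0
  rw [← hxz, add_neg_cancel]

/-- The inner product with a fixed right entry, as a real-linear map of the left entry. -/
noncomputable def innerLeftRealCLM {H : Type*} [NormedAddCommGroup H] [InnerProductSpace ℂ H]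
    (w : H) : H →L[ℝ] ℂ :=
  (Complex.conjCLE : ℂ →L[ℝ] ℂ).comp ((innerSL ℂ w).restrictScalars ℝ)

theorem innerLeftRealCLM_apply {H : Type*} [NormedAddCommGroup H] [InnerProductSpace ℂ H]
    (w x : H) : innerLeftRealCLM w x = ⟪x, w⟫_ℂ := by
  simp [innerLeftRealCLM]

/-- For a densely defined closed linear operator `A` in a complex
Hilbert space and a strongly continuous `y : [0,∞) → H`, the weak-solution
definition via the adjoint is equivalent to the mild-solution definition. -/
theorem weak_solution_iff_mild_solution
    {H : Type*} [NormedAddCommGroup H] [InnerProductSpace ℂ H] [CompleteSpace H]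
    (A : H →ₗ.[ℂ] H) (hdense : Dense (A.domain : Set H)) (hclosed : A.IsClosed)
    (y : ℝ → H) (hy : ContinuousOn y (Set.Ici (0:ℝ))) :
    (∀ g : A.adjoint.domain, ∀ t ≥ (0:ℝ),
        HasDerivWithinAt (fun s : ℝ => ⟪y s, (g : H)⟫_ℂ)
          ⟪y t, A.adjoint g⟫_ℂ (Set.Ici (0:ℝ)) t)
    ↔ (∀ t ≥ (0:ℝ), ∃ hmem : (∫ s in (0:ℝ)..t, y s) ∈ A.domain,
        y t = y 0 + A ⟨∫ s in (0:ℝ)..t, y s, hmem⟩) := by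
  constructor
  · intro h t ht
    have hsub : Set.uIcc 0 t ⊆ Set.Ici (0 : ℝ) := by
      rw [Set.uIcc_of_le ht]
      exact Set.Icc_subset_Ici_self
    have hyt : ContinuousOn y (Set.uIcc 0 t) := hy.mono hsub
    have hgraph : ((∫ s in (0:ℝ)..t, y s), y t - y 0) ∈ A.graph := by
      refine mem_graph_of_forall_inner_adjoint_eq hdense hclosed fun g => ?_
      have hint : IntervalIntegrable (fun s => ⟪y s, A.adjoint g⟫_ℂ) MeasureTheory.volume 0 t :=
        (hyt.inner continuousOn_const).intervalIntegrable
      have hftc := intervalIntegral.integral_eq_sub_of_hasDeriv_right_of_le ht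
        ((hy.mono Set.Icc_subset_Ici_self).inner continuousOn_const)
        (fun s hs => (h g s hs.1.le).mono fun r hr => hs.1.le.trans (le_of_lt hr)) hint
      have hcomm := (innerLeftRealCLM (A.adjoint g)).intervalIntegral_comp_comm
        (hyt.intervalIntegrable (μ := MeasureTheory.volume))
      simp only [innerLeftRealCLM_apply] at hcomm
      rw [← hcomm, hftc, inner_sub_left]
    rw [LinearPMap.mem_graph_iff] at hgraph
    obtain ⟨u, hu, hAu⟩ := hgraph
    dsimp only at hu hAu
    have hmem : (∫ s in (0:ℝ)..t, y s) ∈ A.domain := hu ▸ u.2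
    refine ⟨hmem, ?_⟩
    have : u = ⟨_, hmem⟩ := Subtype.ext hu
    rw [← this, hAu, add_sub_cancel]
  · intro h g t ht
    have hcont : Continuous fun s : ℝ => y (max s 0) :=
      hy.comp_continuous (by fun_prop) fun s => le_max_right s 0
    have hderiv : HasDerivAt (fun r : ℝ => ∫ s in (0:ℝ)..r, y (max s 0)) (y t) t := by
      simpa [max_eq_left ht] using hcont.integral_hasStrictDerivAt 0 t |>.hasDerivAt
    have hinner := ((innerLeftRealCLM (A.adjoint g)).hasFDerivAt.comp_hasDerivAt t hderiv).const_add
      ⟪y 0, (g : H)⟫_ℂ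
    simp only [innerLeftRealCLM_apply] at hinner
    have heq (s : ℝ) (hs : s ∈ Set.Ici (0 : ℝ)) : ⟪y s, (g : H)⟫_ℂ = ⟪y 0, (g : H)⟫_ℂ +
        (innerLeftRealCLM (A.adjoint g) ∘ fun r : ℝ => ∫ s in (0:ℝ)..r, y (max s 0)) s := by
      obtain ⟨hmem, hys⟩ := h s hs
      have hext : ∫ r in (0:ℝ)..s, y (max r 0) = ∫ r in (0:ℝ)..s, y r := by
        refine intervalIntegral.integral_congr fun r hr => ?_
        rw [Set.uIcc_of_le hs] at hr
        simp only [max_eq_left hr.1]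
      have hadj := (LinearPMap.adjoint_isFormalAdjoint hdense).symm ⟨_, hmem⟩ g
      rw [Function.comp_apply, innerLeftRealCLM_apply, hext, hys, inner_add_left, hadj]
    exact hinner.hasDerivWithinAt.congr heq (heq t ht)
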